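/- Let κ ≠ 0 be a real number, let I, J ⊆ ℝ be open intervals with t + x > 0 for all t ∈ I, x ∈ J, and fix x₀ ∈ J. Let u : ℝ² → ℝ be C³ on I × J and satisfy the Euler–Poisson equation (EP) there. Then there exist a differentiable function S : I → ℝ with continuous derivative S′ and a continuous function R : J → ℝ such that, with F(t,x) = ∫_{x₀}^{x} R(s)·(t+s)^(1/κ) ds and G(t,x) = ∫_{x₀}^{x} R(s)·(t+s)^((1−κ)/κ) ds, one has u(t,x) = (t+x)^(1/κ)·(κ·S′(t) + G(t,x)) − (t+x)^((1−κ)/κ)·(S(t) + F(t,x)) for all (t,x) ∈ I × J. -/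

import Mathlib

open Real Set

/-- Partial derivative with respect to the first variable. -/
noncomputable def pdt (f : ℝ × ℝ → ℝ) (p : ℝ × ℝ) : ℝ :=
  deriv (fun s => f (s, p.2)) p.1

/-- Partial derivative with respect to the second variable. -/
noncomputable def pdx (f : ℝ × ℝ → ℝ) (p : ℝ × ℝ) : ℝ :=
  deriv (fun s => f (p.1, s)) p.2

section PartialDerivatives

variable {f : ℝ × ℝ → ℝ} {U : Set (ℝ × ℝ)} {p : ℝ × ℝ}

theorem hasDerivAt_fst_slice (hf : DifferentiableAt ℝ f p) :
    HasDerivAt (fun s => f (s, p.2)) (fderiv ℝ f p (1, 0)) p.1 :=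
  HasFDerivAt.comp_hasDerivAt (f := fun s => (s, p.2)) p.1 hf.hasFDerivAt
    ((hasDerivAt_id p.1).prodMk (hasDerivAt_const p.1 p.2))

theorem hasDerivAt_snd_slice (hf : DifferentiableAt ℝ f p) :
    HasDerivAt (fun s => f (p.1, s)) (fderiv ℝ f p (0, 1)) p.2 :=
  HasFDerivAt.comp_hasDerivAt (f := fun s => (p.1, s)) p.2 hf.hasFDerivAt
    ((hasDerivAt_const p.2 p.1).prodMk (hasDerivAt_id p.2))

theorem pdt_eq_fderiv (hf : DifferentiableAt ℝ f p) : pdt f p = fderiv ℝ f p (1, 0) :=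
  (hasDerivAt_fst_slice hf).deriv

theorem pdx_eq_fderiv (hf : DifferentiableAt ℝ f p) : pdx f p = fderiv ℝ f p (0, 1) :=
  (hasDerivAt_snd_slice hf).deriv

theorem hasDerivAt_pdt (hf : DifferentiableAt ℝ f p) :
    HasDerivAt (fun s => f (s, p.2)) (pdt f p) p.1 :=
  pdt_eq_fderiv hf ▸ hasDerivAt_fst_slice hf

theorem hasDerivAt_pdx (hf : DifferentiableAt ℝ f p) :
    HasDerivAt (fun s => f (p.1, s)) (pdx f p) p.2 :=
  pdx_eq_fderiv hf ▸ hasDerivAt_snd_slice hf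

theorem ContDiffOn.differentiableAt_of_isOpen {n : WithTop ℕ∞} (hU : IsOpen U)
    (hf : ContDiffOn ℝ n f U) (hn : n ≠ 0) (hp : p ∈ U) : DifferentiableAt ℝ f p :=
  (hf.differentiableOn hn).differentiableAt (hU.mem_nhds hp)

theorem contDiffOn_pdt {n : WithTop ℕ∞} (hU : IsOpen U) (hf : ContDiffOn ℝ (n + 1) f U) :
    ContDiffOn ℝ n (pdt f) U :=
  ((hf.fderiv_of_isOpen hU le_rfl).clm_apply contDiffOn_const).congr fun _ hp =>
    pdt_eq_fderiv (hf.differentiableAt_of_isOpen hU (by simp) hp)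

theorem contDiffOn_pdx {n : WithTop ℕ∞} (hU : IsOpen U) (hf : ContDiffOn ℝ (n + 1) f U) :
    ContDiffOn ℝ n (pdx f) U :=
  ((hf.fderiv_of_isOpen hU le_rfl).clm_apply contDiffOn_const).congr fun _ hp =>
    pdx_eq_fderiv (hf.differentiableAt_of_isOpen hU (by simp) hp)

/-- The mixed second partial derivatives of a `C²` function agree. -/
theorem pdt_pdx_comm (hU : IsOpen U) (hf : ContDiffOn ℝ 2 f U) (hp : p ∈ U) :
    pdt (pdx f) p = pdx (pdt f) p := by
  have hd : ∀ q ∈ U, DifferentiableAt ℝ f q := fun q hq =>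
    hf.differentiableAt_of_isOpen hU (by simp) hq
  have h1 : ContDiffOn ℝ (1 + 1) f U := by simpa [one_add_one_eq_two] using hf
  have hx := (contDiffOn_pdx hU h1).differentiableAt_of_isOpen hU (by simp) hp
  have ht := (contDiffOn_pdt hU h1).differentiableAt_of_isOpen hU (by simp) hp
  have hF : DifferentiableAt ℝ (fderiv ℝ f) p :=
    ((hf.fderiv_of_isOpen hU (m := 1) (by simp [one_add_one_eq_two])).differentiableOn
      (by simp)).differentiableAt (hU.mem_nhds hp)
  have hsymm : IsSymmSndFDerivAt ℝ f p :=
    (hf.contDiffAt (hU.mem_nhds hp)).isSymmSndFDerivAt (by simp)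
  have key : ∀ (g : ℝ × ℝ → ℝ) (v w : ℝ × ℝ), (∀ q ∈ U, g q = fderiv ℝ f q v) →
      fderiv ℝ g p w = fderiv ℝ (fderiv ℝ f) p w v := by
    intro g v w hg
    have he : g =ᶠ[nhds p] fun q => fderiv ℝ f q v :=
      Filter.eventuallyEq_of_mem (hU.mem_nhds hp) hg
    rw [he.fderiv_eq, fderiv_clm_apply hF (differentiableAt_const v)]
    simp
  rw [pdt_eq_fderiv hx, pdx_eq_fderiv ht,
    key (pdx f) (0, 1) (1, 0) fun q hq => pdx_eq_fderiv (hd q hq),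
    key (pdt f) (1, 0) (0, 1) fun q hq => pdt_eq_fderiv (hd q hq)]
  exact hsymm.eq _ _

end PartialDerivatives

/-- For a solution `u` of (EP) with `a = 1 / κ`, this is the function `S + F` of the
representation formula. -/
noncomputable def epPotential (a : ℝ) (u : ℝ × ℝ → ℝ) (p : ℝ × ℝ) : ℝ :=
  (p.1 + p.2) ^ (-a) * ((p.1 + p.2) ^ 2 * pdx u p - a * (p.1 + p.2) * u p)

section Potential

variable {a : ℝ} {u : ℝ × ℝ → ℝ} {U : Set (ℝ × ℝ)} {p : ℝ × ℝ}

theorem contDiffOn_epPotential (hU : IsOpen U) (hpos : ∀ q ∈ U, 0 < q.1 + q.2)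
    (hu : ContDiffOn ℝ 3 u U) : ContDiffOn ℝ 2 (epPotential a u) U := by
  have hy : ContDiffOn ℝ 2 (fun q : ℝ × ℝ => q.1 + q.2) U := by fun_prop
  have hux : ContDiffOn ℝ 2 (pdx u) U := contDiffOn_pdx hU (by rwa [two_add_one_eq_three])
  exact (hy.rpow_const_of_ne fun q hq => (hpos q hq).ne').mul
    (((hy.pow 2).mul hux).sub ((contDiffOn_const.mul hy).mul (hu.of_le (by norm_num))))

theorem hasDerivAt_rpow_add_left {b s c : ℝ} (h : 0 < s + c) :
    HasDerivAt (fun r => (r + c) ^ b) (b * (s + c) ^ b / (s + c)) s := by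
  have := ((hasDerivAt_id s).add_const c).rpow_const (p := b) (Or.inl h.ne')
  refine this.congr_deriv ?_
  simp only [id]
  rw [rpow_sub_one h.ne']
  ring

/-- The first-order relation between a solution of (EP) and its potential. -/
theorem pdt_epPotential (hU : IsOpen U) (hpos : ∀ q ∈ U, 0 < q.1 + q.2)
    (hu : ContDiffOn ℝ 3 u U)
    (hEP : ∀ q ∈ U, pdt (pdx u) q = a * pdt u q / (q.1 + q.2)
      + 2 * (a - 1) * pdx u q / (q.1 + q.2) - 2 * a * (a - 1) * u q / (q.1 + q.2) ^ 2)
    (hp : p ∈ U) :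
    pdt (epPotential a u) p =
      a * epPotential a u p / (p.1 + p.2) + a * (p.1 + p.2) ^ (-a) * u p := by
  have hy := hpos p hp
  have hux : ContDiffOn ℝ 2 (pdx u) U := contDiffOn_pdx hU (by rwa [two_add_one_eq_three])
  have d1 := hasDerivAt_rpow_add_left (b := -a) hy
  have d2 := hasDerivAt_pdt (hu.differentiableAt_of_isOpen hU (by simp) hp)
  have d3 := hasDerivAt_pdt (hux.differentiableAt_of_isOpen hU (by simp) hp)
  have d4 := (hasDerivAt_id p.1).add_const p.2
  have d := d1.mul (((d4.pow 2).mul d3).sub ((d4.const_mul a).mul d2))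
  refine d.deriv.trans ?_
  simp only [id, epPotential, hEP p hp, Pi.mul_apply, Pi.sub_apply, Pi.pow_apply]
  field_simp
  ring

theorem pdx_pdt_epPotential (hU : IsOpen U) (hpos : ∀ q ∈ U, 0 < q.1 + q.2)
    (hu : ContDiffOn ℝ 3 u U)
    (hEP : ∀ q ∈ U, pdt (pdx u) q = a * pdt u q / (q.1 + q.2)
      + 2 * (a - 1) * pdx u q / (q.1 + q.2) - 2 * a * (a - 1) * u q / (q.1 + q.2) ^ 2)
    (hp : p ∈ U) :
    pdx (pdt (epPotential a u)) p = a * pdx (epPotential a u) p / (p.1 + p.2) := by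
  have hy := hpos p hp
  have hW := contDiffOn_epPotential (a := a) hU hpos hu
  have d1 : HasDerivAt (fun r => (p.1 + r) ^ (-a))
      (-a * (p.1 + p.2) ^ (-a) / (p.1 + p.2)) p.2 := by
    rw [add_comm] at hy
    simpa only [add_comm p.1] using hasDerivAt_rpow_add_left (b := -a) hy
  have d2 := hasDerivAt_pdx (hu.differentiableAt_of_isOpen hU (by simp) hp)
  have d3 := hasDerivAt_pdx (hW.differentiableAt_of_isOpen hU (by simp) hp)
  have d4 := (hasDerivAt_id p.2).const_add p.1
  have d := ((d3.const_mul a).div d4 hy.ne').add ((d1.const_mul a).mul d2)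
  have he : (fun s => pdt (epPotential a u) (p.1, s)) =ᶠ[nhds p.2] fun s =>
      a * epPotential a u (p.1, s) / (p.1 + s) + a * (p.1 + s) ^ (-a) * u (p.1, s) := by
    have hc : ContinuousAt (fun s : ℝ => (p.1, s)) p.2 := by fun_prop
    filter_upwards [hc.preimage_mem_nhds (hU.mem_nhds hp)] with s hs
    exact pdt_epPotential hU hpos hu hEP hs
  refine (he.deriv_eq.trans d.deriv).trans ?_
  simp only [id, epPotential]
  field_simp
  ring

end Potential

/-- Every solution of the Euler–Poisson equation (EP) on a product of intervals has the
form u = (t+x)^(1/κ)(κS'(t) + G(t,x)) - (t+x)^((1-κ)/κ)(S(t) + F(t,x)). -/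
theorem representation_of_solutions_of_euler_poisson
    (κ : ℝ) (hκ : κ ≠ 0)
    (I J : Set ℝ) (hIopen : IsOpen I) (hIconn : I.OrdConnected)
    (hJopen : IsOpen J) (hJconn : J.OrdConnected)
    (hpos : ∀ t ∈ I, ∀ x ∈ J, 0 < t + x)
    (x₀ : ℝ) (hx₀ : x₀ ∈ J)
    (u : ℝ × ℝ → ℝ) (hu : ContDiffOn ℝ 3 u (I ×ˢ J))
    (hEP : ∀ p ∈ I ×ˢ J, pdt (pdx u) p =
      pdt u p / (κ * (p.1 + p.2))
      + 2 * (1 - κ) * pdx u p / (κ * (p.1 + p.2))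
      - 2 * (1 - κ) * u p / (κ * (p.1 + p.2)) ^ 2) :
    ∃ S R : ℝ → ℝ, DifferentiableOn ℝ S I ∧ ContinuousOn (deriv S) I ∧
      ContinuousOn R J ∧
      ∀ p ∈ I ×ˢ J, u p =
        (p.1 + p.2) ^ (1 / κ) *
          (κ * deriv S p.1 + ∫ s in x₀..p.2, R s * (p.1 + s) ^ ((1 - κ) / κ))
        - (p.1 + p.2) ^ ((1 - κ) / κ) *
          (S p.1 + ∫ s in x₀..p.2, R s * (p.1 + s) ^ (1 / κ)) := by
  rcases I.eq_empty_or_nonempty with rfl | ⟨t₀, ht₀⟩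
  · exact ⟨0, 0, by simp, by simp, continuousOn_const, by simp⟩
  have hU : IsOpen (I ×ˢ J) := hIopen.prod hJopen
  have hposU : ∀ q ∈ I ×ˢ J, 0 < q.1 + q.2 := fun q hq => hpos _ hq.1 _ hq.2
  have hEP' : ∀ q ∈ I ×ˢ J, pdt (pdx u) q = 1 / κ * pdt u q / (q.1 + q.2)
      + 2 * (1 / κ - 1) * pdx u q / (q.1 + q.2)
      - 2 * (1 / κ) * (1 / κ - 1) * u q / (q.1 + q.2) ^ 2 := by
    intro q hq
    have := hposU q hq
    rw [hEP q hq]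
    field_simp
  have hexp : (1 - κ) / κ = 1 / κ - 1 := by field_simp
  rw [hexp]
  set a := 1 / κ with ha
  have hκa : κ * a = 1 := by rw [ha]; field_simp
  set W := epPotential a u with hWdef
  have hW : ContDiffOn ℝ (1 + 1) W (I ×ˢ J) := by
    simpa [one_add_one_eq_two] using contDiffOn_epPotential (a := a) hU hposU hu
  have hWx : ContDiffOn ℝ 1 (pdx W) (I ×ˢ J) := contDiffOn_pdx hU hW
  have hWt : ContDiffOn ℝ 1 (pdt W) (I ×ˢ J) := contDiffOn_pdt hU hW
  have hWd : ∀ q ∈ I ×ˢ J, DifferentiableAt ℝ W q := fun q hq =>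
    hW.differentiableAt_of_isOpen hU (by simp) hq
  have hWtx : ∀ q ∈ I ×ˢ J, pdx (pdt W) q = a * pdx W q / (q.1 + q.2) := fun q hq =>
    pdx_pdt_epPotential hU hposU hu hEP' hq
  have hconst : ∀ t ∈ I, ∀ x ∈ J,
      (t₀ + x) ^ (-a) * pdx W (t₀, x) = (t + x) ^ (-a) * pdx W (t, x) := by
    intro t ht x hx
    have hd : ∀ r ∈ I, HasDerivAt (fun r => (r + x) ^ (-a) * pdx W (r, x)) 0 r := by
      intro r hr
      have hm : (r, x) ∈ I ×ˢ J := ⟨hr, hx⟩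
      have hy := hpos r hr x hx
      refine ((hasDerivAt_rpow_add_left (b := -a) hy).mul
        (hasDerivAt_pdt (hWx.differentiableAt_of_isOpen hU (by simp) hm))).congr_deriv ?_
      rw [pdt_pdx_comm hU (by simpa [one_add_one_eq_two] using hW) hm, hWtx _ hm]
      ring
    exact hIopen.is_const_of_deriv_eq_zero hIconn.isPreconnected
      (fun r hr => (hd r hr).differentiableAt.differentiableWithinAt)
      (fun r hr => (hd r hr).deriv) ht₀ ht
  have hslice : ∀ {g : ℝ × ℝ → ℝ}, ContinuousOn g (I ×ˢ J) → ∀ t ∈ I,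
      ContinuousOn (fun x => g (t, x)) J := fun hg t ht =>
    hg.comp (by fun_prop) fun x hx => ⟨ht, hx⟩
  have hrpow : ∀ b : ℝ, ∀ t ∈ I, ContinuousOn (fun x => (t + x) ^ b) J := fun b t ht =>
    ContinuousOn.rpow_const (by fun_prop) fun x hx => Or.inl (hpos t ht x hx).ne'
  have hR : ContinuousOn (fun x => (t₀ + x) ^ (-a) * pdx W (t₀, x)) J :=
    (hrpow _ t₀ ht₀).mul (hslice hWx.continuousOn t₀ ht₀)
  have hS : ∀ t ∈ I, HasDerivAt (fun t => W (t, x₀)) (pdt W (t, x₀)) t := fun t ht =>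
    hasDerivAt_pdt (p := (t, x₀)) (hWd _ ⟨ht, hx₀⟩)
  refine ⟨fun t => W (t, x₀), fun x => (t₀ + x) ^ (-a) * pdx W (t₀, x),
    fun t ht => (hS t ht).differentiableAt.differentiableWithinAt, ?_, hR, ?_⟩
  · refine ContinuousOn.congr (f := fun t => pdt W (t, x₀)) ?_ fun t ht => (hS t ht).deriv
    exact hWt.continuousOn.comp (by fun_prop) fun t ht => ⟨ht, hx₀⟩
  rintro ⟨t, x⟩ ⟨ht, hx⟩
  simp only at ht hx ⊢
  have hsub : uIcc x₀ x ⊆ J := hJconn.uIcc_subset hx₀ hx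
  have hint : ∀ b : ℝ, IntervalIntegrable
      (fun s => (t₀ + s) ^ (-a) * pdx W (t₀, s) * (t + s) ^ b) MeasureTheory.volume x₀ x :=
    fun b => ((hR.mul (hrpow b t ht)).mono hsub).intervalIntegrable
  have hF : ∫ s in x₀..x, (t₀ + s) ^ (-a) * pdx W (t₀, s) * (t + s) ^ a
      = W (t, x) - W (t, x₀) := by
    refine intervalIntegral.integral_eq_sub_of_hasDerivAt (f := fun s => W (t, s))
      (fun s hs => ?_) (hint a)
    have hy := hpos t ht s (hsub hs)
    refine (hasDerivAt_pdx (p := (t, s)) (hWd _ ⟨ht, hsub hs⟩)).congr_deriv ?_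
    rw [hconst t ht s (hsub hs), rpow_neg hy.le]
    have := rpow_pos_of_pos hy a
    field_simp
  have hG : ∫ s in x₀..x, (t₀ + s) ^ (-a) * pdx W (t₀, s) * (t + s) ^ (a - 1)
      = κ * pdt W (t, x) - κ * pdt W (t, x₀) := by
    refine intervalIntegral.integral_eq_sub_of_hasDerivAt (f := fun s => κ * pdt W (t, s))
      (fun s hs => ?_) (hint (a - 1))
    have hm : (t, s) ∈ I ×ˢ J := ⟨ht, hsub hs⟩
    have hy := hpos t ht s (hsub hs)
    refine ((hasDerivAt_pdx (hWt.differentiableAt_of_isOpen hU (by simp) hm)).const_mul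
      κ).congr_deriv ?_
    rw [hWtx _ hm, hconst t ht s (hsub hs), rpow_neg hy.le, rpow_sub_one hy.ne',
      mul_div_assoc', ← mul_assoc, hκa]
    have := rpow_pos_of_pos hy a
    field_simp
  have hy := hpos t ht x hx
  have hya := rpow_pos_of_pos hy a
  have hWt' : pdt W (t, x) = a * W (t, x) / (t + x) + a * (t + x) ^ (-a) * u (t, x) :=
    pdt_epPotential hU hposU hu hEP' ⟨ht, hx⟩
  rw [hF, hG, (hS t ht).deriv, add_sub_cancel, add_sub_cancel, hWt', rpow_neg hy.le,
    rpow_sub_one hy.ne']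
  field_simp
  linear_combination (-u (t, x) * (t + x) - (t + x) ^ a * W (t, x)) * hκa
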